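/- Let k, ℓ ≥ 1 be integers, n ≥ 1, γ > 0, and let 0 < p₂ ≤ p₁ ≤ ∞, 0 < q₂ ≤ q₁ ≤ ∞. Define 1/p̃ = 1/p₂ − 1/p₁, 1/q̃ = 1/q₂ − 1/q₁, and σ = (n/(2γ))(1/(k p̃) + 1/(ℓ q̃)) (with 1/∞ = 0). Set ω(x,ξ) = (1 + |x|^k + |ξ|^ℓ)^{2γ}. Then there exists N₀ ∈ ℕ such that for every natural number N ≥ N₀ there is a constant C > 0 with: for all t ∈ (0,1] and all measurable F : ℝⁿ × ℝⁿ → ℂ, ‖F‖_{L^{p₂,q₂}} ≤ C t^{−σ} ‖(1 + t^N ω^N) F‖_{L^{p₁,q₁}}, where ‖G‖_{L^{p,q}} = ( ∫_{ℝⁿ} ( ∫_{ℝⁿ} |G(x,ξ)|^p dx )^{q/p} dξ )^{1/q} denotes the mixed Lebesgue norm (with the usual essential-supremum modifications for p = ∞ or q = ∞). -/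

import Mathlib

open scoped ENNReal
open MeasureTheory

noncomputable section

/-- The `L^p` "norm" (`0 < p ≤ ∞`) of an `ℝ≥0∞`-valued function, with the usual
essential-supremum convention for `p = ∞`. -/
def eLp {α : Type*} [MeasurableSpace α] (p : ℝ≥0∞) (μ : Measure α) (f : α → ℝ≥0∞) : ℝ≥0∞ :=
  if p = ∞ then essSup f μ else (∫⁻ a, f a ^ p.toReal ∂μ) ^ (1 / p.toReal)

/-- The mixed Lebesgue `L^{p,q}` norm on `ℝⁿ × ℝⁿ` (first in `x`, then in `ξ`). -/
def mixedLp (n : ℕ) (p q : ℝ≥0∞)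
    (F : EuclideanSpace ℝ (Fin n) → EuclideanSpace ℝ (Fin n) → ℝ≥0∞) : ℝ≥0∞ :=
  eLp q volume (fun ξ => eLp p volume (fun x => F x ξ))

theorem eLp_mono {α : Type*} [MeasurableSpace α] (p : ℝ≥0∞) (μ : Measure α) {f g : α → ℝ≥0∞}
    (h : ∀ a, f a ≤ g a) : eLp p μ f ≤ eLp p μ g := by
  unfold eLp
  split_ifs
  · exact essSup_mono_ae (Filter.Eventually.of_forall h)
  · gcongr with a
    exact h a

theorem eLp_const_mul {α : Type*} [MeasurableSpace α] {p : ℝ≥0∞} (hp : p ≠ 0) (μ : Measure α)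
    {c : ℝ≥0∞} (hc : c ≠ ∞) (f : α → ℝ≥0∞) :
    eLp p μ (fun a => c * f a) = c * eLp p μ f := by
  unfold eLp
  split_ifs with h
  · exact ENNReal.essSup_const_mul
  · have h0 : 0 < p.toReal := ENNReal.toReal_pos hp h
    simp_rw [ENNReal.mul_rpow_of_nonneg _ _ h0.le]
    rw [lintegral_const_mul' _ _ (by finiteness), ENNReal.mul_rpow_of_nonneg _ _ (by positivity),
      ← ENNReal.rpow_mul, mul_one_div_cancel h0.ne', ENNReal.rpow_one]

/-- Hölder's inequality for `eLp` with a measurable weight; the function `f` need not be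
measurable. -/
theorem eLp_le_weight_mul_eLp {α : Type*} [MeasurableSpace α] {p₁ p₂ : ℝ≥0∞} (hp₂ : 0 < p₂)
    (hp : p₂ < p₁) (μ : Measure α) {v : α → ℝ≥0∞} (hv : Measurable v) (hv₀ : ∀ a, v a ≠ 0)
    (hv₁ : ∀ a, v a ≠ ∞) (f : α → ℝ≥0∞) :
    eLp p₂ μ f ≤ (∫⁻ a, (v a)⁻¹ ^ (1 / (1 / p₂ - 1 / p₁).toReal) ∂μ) ^ (1 / p₂ - 1 / p₁).toReal *
      eLp p₁ μ (fun a => v a * f a) := by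
  have h₂ : p₂ ≠ ∞ := hp.ne_top
  have h0 : 0 < p₂.toReal := ENNReal.toReal_pos hp₂.ne' h₂
  have hdiv (x : ℝ≥0∞) (a : α) : (v a)⁻¹ * (v a * x) = x := by
    rw [← mul_assoc, ENNReal.inv_mul_cancel (hv₀ a) (hv₁ a), one_mul]
  by_cases h₁ : p₁ = ∞
  · subst h₁
    have hδ : (1 / p₂ - 1 / ∞).toReal = 1 / p₂.toReal := by simp
    rw [hδ, one_div_one_div]
    simp only [eLp, if_neg h₂, if_true]
    set S := essSup (fun a => v a * f a) μ
    calc (∫⁻ a, f a ^ p₂.toReal ∂μ) ^ (1 / p₂.toReal)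
        ≤ (∫⁻ a, (v a)⁻¹ ^ p₂.toReal * S ^ p₂.toReal ∂μ) ^ (1 / p₂.toReal) := by
          gcongr ?_ ^ _
          refine lintegral_mono_ae ?_
          filter_upwards [ENNReal.ae_le_essSup (μ := μ) fun a => v a * f a] with a ha
          rw [← ENNReal.mul_rpow_of_nonneg _ _ h0.le]
          gcongr
          rw [← hdiv (f a) a]
          gcongr
      _ = _ := by
          rw [lintegral_mul_const _ (by fun_prop), ENNReal.mul_rpow_of_nonneg _ _ (by positivity),
            ← ENNReal.rpow_mul S, mul_one_div_cancel h0.ne', ENNReal.rpow_one]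
  · have h0' : p₂.toReal < p₁.toReal := (ENNReal.toReal_lt_toReal h₂ h₁).2 hp
    have hδ : (1 / p₂ - 1 / p₁).toReal = 1 / p₂.toReal - 1 / p₁.toReal := by
      rw [ENNReal.toReal_sub_of_le (by gcongr) (by simpa using hp₂.ne')]
      simp
    rw [hδ]
    set δ := 1 / p₂.toReal - 1 / p₁.toReal with hδ'
    have hδ0 : 0 < δ := sub_pos.2 (one_div_lt_one_div_of_lt h0 h0')
    simp only [eLp, if_neg h₂, if_neg h₁]
    obtain ⟨h, hm, hle, heq⟩ := exists_measurable_le_lintegral_eq μ (fun a => f a ^ p₂.toReal)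
    have key := ENNReal.lintegral_Lp_mul_le_Lq_mul_Lr h0 h0' (r := 1 / δ)
      (by rw [one_div_one_div]; ring) μ (f := fun a => v a * h a ^ (1 / p₂.toReal))
      (g := fun a => (v a)⁻¹) (by fun_prop) (by fun_prop)
    rw [heq, mul_comm]
    calc (∫⁻ a, h a ∂μ) ^ (1 / p₂.toReal)
        = (∫⁻ a, ((fun a => v a * h a ^ (1 / p₂.toReal)) * fun a => (v a)⁻¹) a ^ p₂.toReal ∂μ) ^
            (1 / p₂.toReal) := by
          congr 2 with a
          rw [Pi.mul_apply, mul_comm, hdiv, ← ENNReal.rpow_mul, one_div_mul_cancel h0.ne',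
            ENNReal.rpow_one]
      _ ≤ _ := key
      _ ≤ _ := by
          rw [one_div_one_div]
          gcongr with a
          calc h a ^ (1 / p₂.toReal) ≤ (f a ^ p₂.toReal) ^ (1 / p₂.toReal) := by
                gcongr
                exact hle a
            _ = f a := by
                rw [← ENNReal.rpow_mul, mul_one_div_cancel h0.ne', ENNReal.rpow_one]

theorem lintegral_comp_smul_of_pos {E : Type*} [NormedAddCommGroup E] [NormedSpace ℝ E]
    [FiniteDimensional ℝ E] [MeasurableSpace E] [BorelSpace E] (μ : Measure E)
    [μ.IsAddHaarMeasure] {g : E → ℝ≥0∞} (hg : Measurable g) {s : ℝ} (hs : 0 < s) :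
    ∫⁻ x, g (s • x) ∂μ =
      ENNReal.ofReal (s ^ (-(Module.finrank ℝ E : ℝ))) * ∫⁻ x, g x ∂μ := by
  rw [← lintegral_map hg (measurable_const_smul s), Measure.map_addHaar_smul μ hs.ne',
    lintegral_smul_measure, abs_of_pos (by positivity), Real.rpow_neg hs.le, Real.rpow_natCast,
    smul_eq_mul]

/-- Dividing by the dilated weight `(1 + s|x|)^M` costs a factor `s` to the power
`-n (1/p₂ - 1/p₁)`. -/
theorem exists_eLp_le_rpow_mul_eLp_one_add_norm {E : Type*} [NormedAddCommGroup E]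
    [NormedSpace ℝ E] [FiniteDimensional ℝ E] [MeasurableSpace E] [BorelSpace E] (μ : Measure E)
    [μ.IsAddHaarMeasure] {p₁ p₂ : ℝ≥0∞} (hp₂ : 0 < p₂) (hp : p₂ ≤ p₁) {M : ℝ} (hM₀ : 0 ≤ M)
    (hM : Module.finrank ℝ E * (1 / p₂ - 1 / p₁).toReal < M) :
    ∃ C : ℝ, 0 < C ∧ ∀ s : ℝ, 0 < s → ∀ f : E → ℝ≥0∞,
      eLp p₂ μ f ≤
        ENNReal.ofReal (C * s ^ (-(Module.finrank ℝ E * (1 / p₂ - 1 / p₁).toReal))) *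
          eLp p₁ μ (fun x => ENNReal.ofReal ((1 + s * ‖x‖) ^ M) * f x) := by
  rcases hp.eq_or_lt with rfl | hlt
  · refine ⟨1, one_pos, fun s hs f => ?_⟩
    simp only [tsub_self, ENNReal.toReal_zero, mul_zero, neg_zero, Real.rpow_zero, mul_one,
      ENNReal.ofReal_one, one_mul]
    refine eLp_mono _ _ fun x => le_mul_of_one_le_left' ?_
    rw [ENNReal.one_le_ofReal]
    exact Real.one_le_rpow (le_add_of_nonneg_right (by positivity)) hM₀
  have hδtop : 1 / p₂ - 1 / p₁ ≠ ∞ :=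
    ne_top_of_le_ne_top (by simpa using hp₂.ne') tsub_le_self
  have hδ : 0 < (1 / p₂ - 1 / p₁).toReal :=
    ENNReal.toReal_pos (tsub_pos_of_lt (by simpa using hlt)).ne' hδtop
  set δ := (1 / p₂ - 1 / p₁).toReal with hδ_def
  set g : E → ℝ≥0∞ := fun x => ENNReal.ofReal ((1 + ‖x‖) ^ (-(M / δ))) with hg_def
  have hg : Measurable g := by fun_prop
  have hfin : ∫⁻ x, g x ∂μ < ∞ := finite_integral_one_add_norm ((lt_div_iff₀ hδ).2 hM)
  set K := ∫⁻ x, g x ∂μ with hK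
  refine ⟨(K ^ δ).toReal + 1, by positivity, fun s hs f => ?_⟩
  have hb (x : E) : 0 < 1 + s * ‖x‖ := by positivity
  refine (eLp_le_weight_mul_eLp hp₂ hlt μ (v := fun x => ENNReal.ofReal ((1 + s * ‖x‖) ^ M))
    (by fun_prop) (fun x => by simpa using Real.rpow_pos_of_pos (hb x) M) (by simp) f).trans ?_
  gcongr
  have hint : ∫⁻ x, (ENNReal.ofReal ((1 + s * ‖x‖) ^ M))⁻¹ ^ (1 / δ) ∂μ =
      ENNReal.ofReal (s ^ (-(Module.finrank ℝ E : ℝ))) * K := by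
    rw [hK, ← lintegral_comp_smul_of_pos μ hg hs]
    congr with x
    rw [hg_def, ← ENNReal.ofReal_inv_of_pos (Real.rpow_pos_of_pos (hb x) M),
      ENNReal.ofReal_rpow_of_pos (inv_pos.2 (Real.rpow_pos_of_pos (hb x) M)),
      ← Real.rpow_neg (hb x).le, ← Real.rpow_mul (hb x).le]
    simp only [norm_smul, Real.norm_of_nonneg hs.le]
    congr 2
    ring
  rw [← hδ_def, hint, ENNReal.mul_rpow_of_nonneg _ _ hδ.le,
    ENNReal.ofReal_rpow_of_pos (Real.rpow_pos_of_pos hs _), ← Real.rpow_mul hs.le, neg_mul,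
    mul_comm, ENNReal.ofReal_mul (by positivity)]
  gcongr
  rw [← ENNReal.ofReal_toReal (ENNReal.rpow_ne_top_of_nonneg hδ.le hfin.ne)]
  exact ENNReal.ofReal_le_ofReal (by simp)

theorem one_add_mul_rpow_le_two_rpow_mul_one_add {k : ℕ} {γ t a b : ℝ} {N : ℕ} (hk : 1 ≤ k)
    (hγ : 0 < γ) (ht : 0 < t) (ha : 0 ≤ a) (hab : a ^ k ≤ b) :
    (1 + t ^ (1 / (2 * γ * k)) * a) ^ (γ * k * N) ≤
      2 ^ (γ * k * N) * Real.sqrt (max 1 (t * b ^ (2 * γ)) ^ N) := by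
  have hk' : (0 : ℝ) < k := by exact_mod_cast hk
  have hb : 0 ≤ b := (pow_nonneg ha k).trans hab
  set u := t ^ (1 / (2 * γ * k)) * a with hu
  have hu0 : 0 ≤ u := by positivity
  have hpow : u ^ (2 * γ * k) ≤ t * b ^ (2 * γ) := by
    rw [hu, Real.mul_rpow (by positivity) ha, ← Real.rpow_mul ht.le,
      one_div_mul_cancel (by positivity), Real.rpow_one, mul_comm (2 * γ) (k : ℝ),
      Real.rpow_mul ha, Real.rpow_natCast]
    gcongr
  have hmax : max 1 u ^ (2 * γ * k) ≤ max 1 (t * b ^ (2 * γ)) := by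
    rcases le_total u 1 with h | h
    · simp [max_eq_left h]
    · rw [max_eq_right h]
      exact hpow.trans (le_max_right _ _)
  have hm : 0 < max 1 u := lt_max_of_lt_left one_pos
  calc (1 + u) ^ (γ * k * N) ≤ (2 * max 1 u) ^ (γ * k * N) := by
        gcongr
        linarith [le_max_left 1 u, le_max_right 1 u]
    _ = 2 ^ (γ * k * N) * max 1 u ^ (γ * k * N) := Real.mul_rpow (by norm_num) hm.le
    _ ≤ _ := by
        gcongr
        refine Real.le_sqrt_of_sq_le ?_
        calc (max 1 u ^ (γ * k * N)) ^ 2 = (max 1 u ^ (2 * γ * k)) ^ N := by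
              rw [← Real.rpow_natCast, ← Real.rpow_natCast, ← Real.rpow_mul hm.le,
                ← Real.rpow_mul hm.le]
              congr 1
              push_cast
              ring
          _ ≤ _ := by gcongr

/-- The weight `1 + (t ω)^N` dominates a product of dilated weights in each variable. -/
theorem mul_rpow_le_one_add_pow_mul {k l N : ℕ} {γ t a b : ℝ} (hk : 1 ≤ k) (hl : 1 ≤ l)
    (hγ : 0 < γ) (ht : 0 < t) (ha : 0 ≤ a) (hb : 0 ≤ b) :
    (1 + t ^ (1 / (2 * γ * l)) * b) ^ (γ * l * N) * (1 + t ^ (1 / (2 * γ * k)) * a) ^ (γ * k * N) ≤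
      2 ^ (γ * l * N) * 2 ^ (γ * k * N) *
        (1 + t ^ N * ((1 + a ^ k + b ^ l) ^ (2 * γ)) ^ N) := by
  have hak : 0 ≤ a ^ k := by positivity
  have hbl : 0 ≤ b ^ l := by positivity
  have h₁ := one_add_mul_rpow_le_two_rpow_mul_one_add (N := N) hk hγ ht ha
    (b := 1 + a ^ k + b ^ l) (by linarith)
  have h₂ := one_add_mul_rpow_le_two_rpow_mul_one_add (N := N) hl hγ ht hb
    (b := 1 + a ^ k + b ^ l) (by linarith)
  set A := t * (1 + a ^ k + b ^ l) ^ (2 * γ) with hA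
  have hA0 : 0 ≤ A := by positivity
  have hmax : max 1 A ^ N ≤ 1 + A ^ N := by
    rcases le_total A 1 with h | h
    · simp [max_eq_left h, hA0]
    · simp [max_eq_right h]
  refine (mul_le_mul h₂ h₁ (by positivity) (by positivity)).trans ?_
  rw [mul_mul_mul_comm, Real.mul_self_sqrt (by positivity), ← mul_pow, ← hA]
  gcongr

/-- With `1/p̃ = 1/p₂ - 1/p₁`, `1/q̃ = 1/q₂ - 1/q₁`,
`σ = (n/(2γ))(1/(k p̃) + 1/(ℓ q̃))` and `ω(x,ξ) = (1+|x|^k+|ξ|^ℓ)^{2γ}`, for `N` large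
enough one has `‖F‖_{L^{p₂,q₂}} ≤ C t^{-σ} ‖(1 + t^N ω^N) F‖_{L^{p₁,q₁}}` for all
`0 < t ≤ 1` and all measurable `F`. -/
theorem mixed_norm_weight_division (k l n : ℕ) (γ : ℝ) (p₁ p₂ q₁ q₂ : ℝ≥0∞)
    (hk : 1 ≤ k) (hl : 1 ≤ l) (hn : 1 ≤ n) (hγ : 0 < γ)
    (hp₂ : 0 < p₂) (hq₂ : 0 < q₂) (hp : p₂ ≤ p₁) (hq : q₂ ≤ q₁) :
    ∃ N₀ : ℕ, ∀ N : ℕ, N₀ ≤ N → ∃ C : ℝ, 0 < C ∧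
      ∀ t : ℝ, t ∈ Set.Ioc (0 : ℝ) 1 →
        ∀ F : EuclideanSpace ℝ (Fin n) → EuclideanSpace ℝ (Fin n) → ℂ,
          Measurable (fun p : EuclideanSpace ℝ (Fin n) × EuclideanSpace ℝ (Fin n) =>
            F p.1 p.2) →
          mixedLp n p₂ q₂ (fun x ξ => ENNReal.ofReal ‖F x ξ‖) ≤
            ENNReal.ofReal
                (C * t ^ (-((n : ℝ) / (2 * γ) *
                  ((1 / p₂ - 1 / p₁).toReal / k + (1 / q₂ - 1 / q₁).toReal / l)))) *
              mixedLp n p₁ q₁ (fun x ξ =>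
                ENNReal.ofReal
                  ((1 + t ^ N * ((1 + ‖x‖ ^ k + ‖ξ‖ ^ l) ^ (2 * γ)) ^ N) * ‖F x ξ‖)) := by
  obtain ⟨N₀, hN₀⟩ := exists_nat_gt
    ((n * (1 / p₂ - 1 / p₁).toReal + n * (1 / q₂ - 1 / q₁).toReal) / γ)
  rw [div_lt_iff₀ hγ] at hN₀
  refine ⟨N₀, fun N hN => ?_⟩
  have hk' : (1 : ℝ) ≤ k := by exact_mod_cast hk
  have hl' : (1 : ℝ) ≤ l := by exact_mod_cast hl
  have hN' : (N₀ : ℝ) ≤ N := by exact_mod_cast hN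
  have hlarge : n * (1 / p₂ - 1 / p₁).toReal + n * (1 / q₂ - 1 / q₁).toReal < γ * N := by
    nlinarith
  have hpn : 0 ≤ n * (1 / p₂ - 1 / p₁).toReal := by positivity
  have hqn : 0 ≤ n * (1 / q₂ - 1 / q₁).toReal := by positivity
  have hexp {m : ℝ} (hm : 1 ≤ m) : γ * N ≤ γ * m * N := by
    rw [mul_right_comm]
    exact le_mul_of_one_le_right (by positivity) hm
  have hkN := hexp hk'
  have hlN := hexp hl'
  have hfin : Module.finrank ℝ (EuclideanSpace ℝ (Fin n)) = n := finrank_euclideanSpace_fin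
  obtain ⟨C₁, hC₁, h₁⟩ := exists_eLp_le_rpow_mul_eLp_one_add_norm
    (volume : Measure (EuclideanSpace ℝ (Fin n))) hp₂ hp (M := γ * k * N) (by positivity)
    (by rw [hfin]; linarith)
  obtain ⟨C₂, hC₂, h₂⟩ := exists_eLp_le_rpow_mul_eLp_one_add_norm
    (volume : Measure (EuclideanSpace ℝ (Fin n))) hq₂ hq (M := γ * l * N) (by positivity)
    (by rw [hfin]; linarith)
  rw [hfin] at h₁ h₂
  set δ₁ := (1 / p₂ - 1 / p₁).toReal
  set δ₂ := (1 / q₂ - 1 / q₁).toReal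
  set D : ℝ := 2 ^ (γ * l * N) * 2 ^ (γ * k * N) with hD
  refine ⟨C₁ * C₂ * D, by positivity, fun t ht F _ => ?_⟩
  have ht₀ : 0 < t := ht.1
  have hp₁ : p₁ ≠ 0 := (hp₂.trans_le hp).ne'
  have hq₁ : q₁ ≠ 0 := (hq₂.trans_le hq).ne'
  set a := t ^ (1 / (2 * γ * k)) with ha
  set b := t ^ (1 / (2 * γ * l)) with hb
  have ha₀ : 0 < a := by positivity
  have hb₀ : 0 < b := by positivity
  set c₁ := C₁ * a ^ (-(n * δ₁)) with hc₁
  set c₂ := C₂ * b ^ (-(n * δ₂)) with hc₂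
  have hconst : C₁ * C₂ * D * t ^ (-((n : ℝ) / (2 * γ) * (δ₁ / k + δ₂ / l))) = c₂ * (c₁ * D) := by
    have hsplit : -((n : ℝ) / (2 * γ) * (δ₁ / k + δ₂ / l)) =
        1 / (2 * γ * k) * -(n * δ₁) + 1 / (2 * γ * l) * -(n * δ₂) := by
      field_simp
      ring
    rw [hsplit, Real.rpow_add ht₀, Real.rpow_mul ht₀.le, Real.rpow_mul ht₀.le, hc₁, hc₂, ha, hb]
    ring
  have hc₁0 : 0 < c₁ := by positivity
  have hc₂0 : 0 < c₂ := by positivity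
  have hD0 : 0 < D := by positivity
  rw [hconst, ENNReal.ofReal_mul hc₂0.le, mul_assoc]
  unfold mixedLp
  refine (h₂ b hb₀ _).trans ?_
  gcongr
  rw [← eLp_const_mul hq₁ _ ENNReal.ofReal_ne_top]
  refine eLp_mono _ _ fun ξ => ?_
  refine (mul_le_mul_right (h₁ a ha₀ _) _).trans ?_
  rw [mul_left_comm, ENNReal.ofReal_mul hc₁0.le, mul_assoc (ENNReal.ofReal c₁)]
  refine mul_le_mul_right ?_ _
  rw [← eLp_const_mul hp₁ _ ENNReal.ofReal_ne_top, ← eLp_const_mul hp₁ _ ENNReal.ofReal_ne_top]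
  refine eLp_mono _ _ fun x => ?_
  rw [← ENNReal.ofReal_mul (by positivity), ← ENNReal.ofReal_mul (by positivity),
    ← ENNReal.ofReal_mul hD0.le, ← mul_assoc, ← mul_assoc]
  exact ENNReal.ofReal_le_ofReal (mul_le_mul_of_nonneg_right
    (mul_rpow_le_one_add_pow_mul hk hl hγ ht₀ (norm_nonneg x) (norm_nonneg ξ)) (norm_nonneg _))
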